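/- arXiv:1002.0384 — 2 statements merged into one kernel-verified Lean document; each statement's English description precedes it below -/
import Mathlib

section
/- Let (n, ⟨·,·⟩₁) be a nilsoliton with Ricci operator Ric₁ = cI + D₁, where c < 0 and D₁ is a derivation of n, and let a be any abelian Lie algebra of ⟨·,·⟩₁-symmetric derivations of n. Then the associated metric solvable Lie algebra s = a ⋉ n, with inner product ⟨·,·⟩ restricting to ⟨·,·⟩₁ on n, making a ⊥ n, and with ⟨A, A'⟩ = -(1/c)·tr(A A') for A, A' ∈ a, is a solsoliton: its Ricci operator is Ric = cI + D, where D is the derivation of s with D|_a = 0 and D|_n = D₁ - ad H|_n, H being the mean curvature vector of s. -/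
noncomputable section

open scoped RealInnerProductSpace

/-! ### Lie-algebraic notions for a bracket given as a bundled bilinear map -/

section Alg

variable {E : Type*} [AddCommGroup E] [Module ℝ E]

/-- `μ` is a Lie bracket: alternating and satisfying the (Leibniz form of the) Jacobi identity. -/
def IsLieBracket (μ : E →ₗ[ℝ] E →ₗ[ℝ] E) : Prop :=
  (∀ X, μ X X = 0) ∧ ∀ X Y Z, μ X (μ Y Z) = μ (μ X Y) Z + μ Y (μ X Z)

/-- `D` is a derivation of the algebra `(E, μ)`. -/
def IsDeriv (μ : E →ₗ[ℝ] E →ₗ[ℝ] E) (D : E →ₗ[ℝ] E) : Prop :=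
  ∀ X Y, D (μ X Y) = μ (D X) Y + μ X (D Y)

/-- The subspace spanned by brackets of elements of `p` and `q`. -/
def bracketSpan (μ : E →ₗ[ℝ] E →ₗ[ℝ] E) (p q : Submodule ℝ E) : Submodule ℝ E :=
  Submodule.span ℝ {z | ∃ x ∈ p, ∃ y ∈ q, μ x y = z}

/-- Derived series of `(E, μ)`. -/
def derSeries (μ : E →ₗ[ℝ] E →ₗ[ℝ] E) : ℕ → Submodule ℝ E
  | 0 => ⊤
  | k + 1 => bracketSpan μ (derSeries μ k) (derSeries μ k)

/-- `(E, μ)` is a solvable Lie algebra. -/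
def IsSolvableB (μ : E →ₗ[ℝ] E →ₗ[ℝ] E) : Prop := ∃ k, derSeries μ k = ⊥

/-- Lower central series of the subalgebra `p` of `(E, μ)`. -/
def lcsOn (μ : E →ₗ[ℝ] E →ₗ[ℝ] E) (p : Submodule ℝ E) : ℕ → Submodule ℝ E
  | 0 => p
  | k + 1 => bracketSpan μ p (lcsOn μ p k)

/-- The subalgebra `p` of `(E, μ)` is a nilpotent Lie algebra. -/
def IsNilpotentOn (μ : E →ₗ[ℝ] E →ₗ[ℝ] E) (p : Submodule ℝ E) : Prop := ∃ k, lcsOn μ p k = ⊥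

/-- `p` is an ideal of `(E, μ)`. -/
def IsIdeal (μ : E →ₗ[ℝ] E →ₗ[ℝ] E) (p : Submodule ℝ E) : Prop := ∀ X : E, ∀ Y ∈ p, μ X Y ∈ p

/-- `p` is the nilradical (maximal nilpotent ideal) of `(E, μ)`. -/
def IsNilradical (μ : E →ₗ[ℝ] E →ₗ[ℝ] E) (p : Submodule ℝ E) : Prop :=
  IsIdeal μ p ∧ IsNilpotentOn μ p ∧ ∀ q, IsIdeal μ q → IsNilpotentOn μ q → q ≤ p

/-- The natural action `π(f)μ` of `f ∈ End(E)` on bilinear maps: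
`(π(f)μ)(X,Y) = f(μ(X,Y)) - μ(fX,Y) - μ(X,fY)`. -/
def piAct (f : E →ₗ[ℝ] E) (μ : E →ₗ[ℝ] E →ₗ[ℝ] E) : E →ₗ[ℝ] E →ₗ[ℝ] E :=
  (LinearMap.llcomp ℝ E E E f) ∘ₗ μ - μ ∘ₗ f - (LinearMap.lcomp ℝ E f) ∘ₗ μ

/-- The center of `(E, μ)`. -/
def centerB (μ : E →ₗ[ℝ] E →ₗ[ℝ] E) : Submodule ℝ E where
  carrier := {X | μ X = 0}
  add_mem' := by intro a b ha hb; simp only [Set.mem_setOf_eq, map_add] at *; rw [ha, hb, add_zero]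
  zero_mem' := by simp only [Set.mem_setOf_eq, map_zero]
  smul_mem' := by intro c a ha; simp only [Set.mem_setOf_eq, map_smul] at *; rw [ha, smul_zero]

end Alg

/-! ### Metric notions -/

section MetricDefs

variable {E : Type*} [NormedAddCommGroup E] [InnerProductSpace ℝ E] [FiniteDimensional ℝ E]

/-- The transpose of an operator with respect to the inner product. -/
def transp (f : E →ₗ[ℝ] E) : E →ₗ[ℝ] E := LinearMap.adjoint f

/-- The symmetric part `S(f) = (f + fᵗ)/2` of an operator. -/
def symPart (f : E →ₗ[ℝ] E) : E →ₗ[ℝ] E := (1 / 2 : ℝ) • (f + transp f)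

variable (E) in
/-- A fixed orthonormal basis of `E`. -/
def stdONB : OrthonormalBasis (Fin (Module.finrank ℝ E)) ℝ E := stdOrthonormalBasis ℝ E

/-- The operator `R` appearing in the formula for the Ricci operator of a metric Lie algebra:
`⟨R X, X⟩ = -(1/2) Σ ⟨[X,Xᵢ],Xⱼ⟩² + (1/4) Σ ⟨[Xᵢ,Xⱼ],X⟩²` for any orthonormal basis `{Xᵢ}`. -/
def Rop (μ : E →ₗ[ℝ] E →ₗ[ℝ] E) : E →ₗ[ℝ] E :=
  (-(1 / 2 : ℝ)) • ∑ i, (transp (μ (stdONB E i))) ∘ₗ (μ (stdONB E i))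
    + (1 / 4 : ℝ) • ∑ i, (μ (stdONB E i)) ∘ₗ (transp (μ (stdONB E i)))

/-- The symmetric operator `B` defined by the Killing form: `⟨B X, X⟩ = tr((ad X)²)`. -/
def Bop (μ : E →ₗ[ℝ] E →ₗ[ℝ] E) : E →ₗ[ℝ] E :=
  ∑ i, (((LinearMap.trace ℝ E) ∘ₗ (LinearMap.lcomp ℝ E (μ (stdONB E i))) ∘ₗ μ).smulRight
    (stdONB E i))

/-- The mean curvature vector `H`, characterized by `⟨H, X⟩ = tr (ad X)`. -/
def meanCurv (μ : E →ₗ[ℝ] E →ₗ[ℝ] E) : E :=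
  ∑ i, (LinearMap.trace ℝ E (μ (stdONB E i))) • (stdONB E i : E)

/-- The Ricci operator `Ric = R - (1/2) B - S(ad H)` of a metric Lie algebra. -/
def Ric (μ : E →ₗ[ℝ] E →ₗ[ℝ] E) : E →ₗ[ℝ] E :=
  Rop μ - (1 / 2 : ℝ) • Bop μ - symPart (μ (meanCurv μ))

/-- `(E, μ, ⟨⬝,⬝⟩)` is a solsoliton: `Ric = c I + D` for some `c ∈ ℝ` and derivation `D`. -/
def IsSolsoliton (μ : E →ₗ[ℝ] E →ₗ[ℝ] E) : Prop :=
  ∃ (c : ℝ) (D : E →ₗ[ℝ] E), IsDeriv μ D ∧ Ric μ = c • LinearMap.id + D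

/-- The natural inner product on bilinear maps, `⟨μ,ν⟩ = Σ ⟨μ(Xᵢ,Xⱼ), ν(Xᵢ,Xⱼ)⟩`. -/
def binner (μ ν : E →ₗ[ℝ] E →ₗ[ℝ] E) : ℝ :=
  ∑ i, ∑ j, ⟪μ (stdONB E i) (stdONB E j), ν (stdONB E i) (stdONB E j)⟫

/-- Orthogonal projection onto a subspace, as an endomorphism of `E`. -/
def projL (p : Submodule ℝ E) : E →ₗ[ℝ] E :=
  p.subtype ∘ₗ (Submodule.orthogonalProjection p).toLinearMap

/-- An orthonormal basis of the subspace `p`, as a family of vectors of `E`. -/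
def onbOf (p : Submodule ℝ E) : Fin (Module.finrank ℝ ↥p) → E :=
  fun i => ((stdOrthonormalBasis ℝ ↥p) i : E)

/-- The restriction `ad X |_p` of `ad X` to the subspace `p`, as an endomorphism of `E`
(it kills `pᗮ`). -/
def adOn (μ : E →ₗ[ℝ] E →ₗ[ℝ] E) (p : Submodule ℝ E) (X : E) : E →ₗ[ℝ] E :=
  (μ X) ∘ₗ projL p

/-- The Ricci operator of the restricted metric Lie algebra `(p, μ|ₚ, ⟨⬝,⬝⟩|ₚ)`, for `p` a
bracket-closed subspace, realized as an endomorphism of `E` killing `pᗮ`.  (For `p` nilpotent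
this is the full Ricci operator of `p`.) -/
def RopOn (μ : E →ₗ[ℝ] E →ₗ[ℝ] E) (p : Submodule ℝ E) : E →ₗ[ℝ] E :=
  (-(1 / 2 : ℝ)) • ∑ i, (transp (adOn μ p (onbOf p i))) ∘ₗ (adOn μ p (onbOf p i))
    + (1 / 4 : ℝ) • ∑ i, (adOn μ p (onbOf p i)) ∘ₗ (transp (adOn μ p (onbOf p i)))

/-- The metric nilpotent Lie algebra `(p, μ|ₚ, ⟨⬝,⬝⟩|ₚ)` is a nilsoliton with Ricci operator
`c I + D₁`, where `D₁` is (induced by) a derivation of `p`. -/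
def IsNilsolitonOn (μ : E →ₗ[ℝ] E →ₗ[ℝ] E) (p : Submodule ℝ E) (c : ℝ) (D₁ : E →ₗ[ℝ] E) :
    Prop :=
  (∀ X ∈ p, D₁ X ∈ p) ∧ (∀ X ∈ p, ∀ Y ∈ p, D₁ (μ X Y) = μ (D₁ X) Y + μ X (D₁ Y)) ∧
    ∀ X ∈ p, RopOn μ p X = c • X + D₁ X

end MetricDefs

section SymmetricSums

variable {E : Type*} [NormedAddCommGroup E] [InnerProductSpace ℝ E]
variable {ι : Type*} [Fintype ι]

lemma OrthonormalBasis.sum_bilin_symmetric (b : OrthonormalBasis ι ℝ E)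
    (β : E →ₗ[ℝ] E →ₗ[ℝ] ℝ) {T : E →ₗ[ℝ] E} (hT : T.IsSymmetric) :
    ∑ i, β (T (b i)) (b i) = ∑ i, β (b i) (T (b i)) := by
  have h1 : ∀ i, β (T (b i)) (b i) = ∑ j, ⟪b j, T (b i)⟫ * β (b j) (b i) := fun i => by
    conv_lhs => rw [← b.sum_repr' (T (b i))]
    simp
  have h2 : ∀ i, β (b i) (T (b i)) = ∑ j, ⟪b j, T (b i)⟫ * β (b i) (b j) := fun i => by
    conv_lhs => rw [← b.sum_repr' (T (b i))]
    simp
  simp_rw [h1, h2]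
  rw [Finset.sum_comm]
  refine Finset.sum_congr rfl fun i _ => Finset.sum_congr rfl fun j _ => ?_
  rw [← hT, real_inner_comm]

lemma OrthonormalBasis.sum_inner_symmetric (b : OrthonormalBasis ι ℝ E)
    {W : Type*} [NormedAddCommGroup W] [InnerProductSpace ℝ W]
    (F G : E →ₗ[ℝ] W) {T : E →ₗ[ℝ] E} (hT : T.IsSymmetric) :
    ∑ i, ⟪F (T (b i)), G (b i)⟫ = ∑ i, ⟪F (b i), G (T (b i))⟫ := by
  simpa using b.sum_bilin_symmetric ((innerₗ W).compl₁₂ F G) hT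

lemma OrthonormalBasis.sum_mul_symmetric (b : OrthonormalBasis ι ℝ E)
    (F G : E →ₗ[ℝ] ℝ) {T : E →ₗ[ℝ] E} (hT : T.IsSymmetric) :
    ∑ i, F (T (b i)) * G (b i) = ∑ i, F (b i) * G (T (b i)) := by
  simpa using b.sum_bilin_symmetric ((LinearMap.mul ℝ ℝ).compl₁₂ F G) hT

variable [FiniteDimensional ℝ E]

lemma projL_mem (p : Submodule ℝ E) (x : E) : projL p x ∈ p := by
  simp [projL]

lemma projL_of_mem {p : Submodule ℝ E} {x : E} (hx : x ∈ p) : projL p x = x := by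
  simpa [projL] using Submodule.starProjection_eq_self_iff.2 hx

lemma projL_of_mem_orthogonal {p : Submodule ℝ E} {x : E} (hx : x ∈ pᗮ) : projL p x = 0 := by
  simp [projL, Submodule.orthogonalProjectionOnto_apply_of_mem_orthogonal hx]

lemma sub_projL_mem (p : Submodule ℝ E) (x : E) : x - projL p x ∈ pᗮ := by
  simp [projL]

lemma projL_isSymmetric (p : Submodule ℝ E) : (projL p).IsSymmetric := fun x y => by
  simpa [projL] using Submodule.starProjection_isSymmetric p x y

lemma sum_bilin_projL (b : OrthonormalBasis ι ℝ E) (p : Submodule ℝ E)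
    (β : E →ₗ[ℝ] E →ₗ[ℝ] ℝ) :
    ∑ i, β (projL p (b i)) (projL p (b i)) = ∑ i, β (projL p (b i)) (b i) := by
  have h := b.sum_bilin_symmetric (β.compl₁₂ (projL p) LinearMap.id) (projL_isSymmetric p)
  simp only [LinearMap.compl₁₂_apply, LinearMap.id_apply] at h
  rw [← h]
  simp only [projL_of_mem (projL_mem p _)]

lemma sum_bilin_split (b : OrthonormalBasis ι ℝ E) (p : Submodule ℝ E)
    (β : E →ₗ[ℝ] E →ₗ[ℝ] ℝ) :
    ∑ i, β (b i) (b i) = ∑ i, β (projL p (b i)) (projL p (b i))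
      + ∑ i, β (b i - projL p (b i)) (b i - projL p (b i)) := by
  have h := sum_bilin_projL b p β
  have h' := b.sum_bilin_symmetric β (projL_isSymmetric p)
  simp only [map_sub, LinearMap.sub_apply, Finset.sum_sub_distrib]
  linarith

lemma sum_bilin_onbOf (b : OrthonormalBasis ι ℝ E) (p : Submodule ℝ E)
    (β : E →ₗ[ℝ] E →ₗ[ℝ] ℝ) :
    ∑ j, β (onbOf p j) (onbOf p j) = ∑ i, β (projL p (b i)) (projL p (b i)) := by
  have h1 : ∀ i, projL p (b i) = ∑ j, ⟪onbOf p j, b i⟫ • onbOf p j := fun i => by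
    have := congrArg p.subtype ((stdOrthonormalBasis ℝ p).sum_repr' (p.orthogonalProjectionOnto (b i)))
    simp only [map_sum, map_smul] at this
    simp only [projL, LinearMap.comp_apply]
    refine Eq.trans this.symm ?_
    refine Finset.sum_congr rfl fun j _ => ?_
    simp [onbOf]
  have h2 : ∀ j, β (onbOf p j) (onbOf p j)
      = ∑ i, ⟪onbOf p j, b i⟫ * β (onbOf p j) (b i) := fun j => by
    conv_lhs => enter [2]; rw [← b.sum_repr' (onbOf p j)]
    simp [real_inner_comm]
  rw [sum_bilin_projL]
  simp_rw [h1, h2]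
  rw [Finset.sum_comm]
  simp

lemma sum_inner_split (b : OrthonormalBasis ι ℝ E) (p : Submodule ℝ E)
    {W : Type*} [NormedAddCommGroup W] [InnerProductSpace ℝ W] (F G : E →ₗ[ℝ] W) :
    ∑ i, ⟪F (b i), G (b i)⟫ = ∑ i, ⟪F (projL p (b i)), G (projL p (b i))⟫
      + ∑ i, ⟪F (b i - projL p (b i)), G (b i - projL p (b i))⟫ :=
  sum_bilin_split b p ((innerₗ W).compl₁₂ F G)

lemma sum_mul_split (b : OrthonormalBasis ι ℝ E) (p : Submodule ℝ E) (F G : E →ₗ[ℝ] ℝ) :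
    ∑ i, F (b i) * G (b i) = ∑ i, F (projL p (b i)) * G (projL p (b i))
      + ∑ i, F (b i - projL p (b i)) * G (b i - projL p (b i)) :=
  sum_bilin_split b p ((LinearMap.mul ℝ ℝ).compl₁₂ F G)

lemma sum_inner_onbOf (b : OrthonormalBasis ι ℝ E) (p : Submodule ℝ E)
    {W : Type*} [NormedAddCommGroup W] [InnerProductSpace ℝ W] (F G : E →ₗ[ℝ] W) :
    ∑ j, ⟪F (onbOf p j), G (onbOf p j)⟫ = ∑ i, ⟪F (projL p (b i)), G (projL p (b i))⟫ := by
  simpa using sum_bilin_onbOf b p ((innerₗ W).compl₁₂ F G)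

lemma sum_mul_onbOf (b : OrthonormalBasis ι ℝ E) (p : Submodule ℝ E) (F G : E →ₗ[ℝ] ℝ) :
    ∑ j, F (onbOf p j) * G (onbOf p j) = ∑ i, F (projL p (b i)) * G (projL p (b i)) := by
  simpa using sum_bilin_onbOf b p ((LinearMap.mul ℝ ℝ).compl₁₂ F G)

end SymmetricSums

section RicciForms

variable {E : Type*} [NormedAddCommGroup E] [InnerProductSpace ℝ E] [FiniteDimensional ℝ E]

lemma inner_transp_comp (f : E →ₗ[ℝ] E) (u v : E) : ⟪transp f (f u), v⟫ = ⟪f u, f v⟫ :=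
  LinearMap.adjoint_inner_left _ _ _

lemma inner_comp_transp (f : E →ₗ[ℝ] E) (u v : E) :
    ⟪f (transp f u), v⟫ = ∑ l, ⟪u, f (stdONB E l)⟫ * ⟪v, f (stdONB E l)⟫ := by
  rw [← LinearMap.adjoint_inner_right, ← (stdONB E).sum_inner_mul_inner]
  refine Finset.sum_congr rfl fun l _ => ?_
  simp only [transp, LinearMap.adjoint_inner_left, LinearMap.adjoint_inner_right]
  rw [real_inner_comm v]

lemma inner_Rop (μ : E →ₗ[ℝ] E →ₗ[ℝ] E) (u v : E) :
    ⟪Rop μ u, v⟫ = -(1 / 2) * ∑ i, ⟪μ (stdONB E i) u, μ (stdONB E i) v⟫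
      + (1 / 4) * ∑ i, ∑ l, ⟪u, μ (stdONB E i) (stdONB E l)⟫
          * ⟪v, μ (stdONB E i) (stdONB E l)⟫ := by
  simp only [Rop, LinearMap.add_apply, LinearMap.smul_apply, LinearMap.sum_apply,
    LinearMap.comp_apply, inner_add_left, real_inner_smul_left, sum_inner, inner_transp_comp,
    inner_comp_transp]

lemma inner_RopOn (μ : E →ₗ[ℝ] E →ₗ[ℝ] E) (p : Submodule ℝ E) (u v : E) :
    ⟪RopOn μ p u, v⟫
      = -(1 / 2) * ∑ i, ⟪μ (onbOf p i) (projL p u), μ (onbOf p i) (projL p v)⟫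
      + (1 / 4) * ∑ i, ∑ l, ⟪u, μ (onbOf p i) (projL p (stdONB E l))⟫
          * ⟪v, μ (onbOf p i) (projL p (stdONB E l))⟫ := by
  simp only [RopOn, LinearMap.add_apply, LinearMap.smul_apply, LinearMap.sum_apply,
    LinearMap.comp_apply, inner_add_left, real_inner_smul_left, sum_inner, inner_transp_comp,
    inner_comp_transp]
  simp only [adOn, LinearMap.comp_apply]

lemma inner_Bop (μ : E →ₗ[ℝ] E →ₗ[ℝ] E) (u v : E) :
    ⟪Bop μ u, v⟫ = LinearMap.trace ℝ E (μ u ∘ₗ μ v) := by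
  have h : LinearMap.trace ℝ E (μ u ∘ₗ μ v)
      = (LinearMap.trace ℝ E ∘ₗ LinearMap.llcomp ℝ E E E (μ u) ∘ₗ μ) v := rfl
  rw [h]
  conv_rhs => rw [← (stdONB E).sum_repr' v]
  simp only [Bop, LinearMap.sum_apply, sum_inner, LinearMap.smulRight_apply,
    real_inner_smul_left, map_sum, map_smul, smul_eq_mul]
  exact Finset.sum_congr rfl fun i _ => mul_comm _ _

/-- The bracket `(X, Y) ↦ μ(X', Y')`, where `X'` is the orthogonal projection of `X` on `p`. -/
def restrictBracket (μ : E →ₗ[ℝ] E →ₗ[ℝ] E) (p : Submodule ℝ E) : E →ₗ[ℝ] E →ₗ[ℝ] E :=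
  μ.compl₁₂ (projL p) (projL p)

lemma restrictBracket_apply (μ : E →ₗ[ℝ] E →ₗ[ℝ] E) (p : Submodule ℝ E) (x y : E) :
    restrictBracket μ p x y = μ (projL p x) (projL p y) := rfl

lemma Rop_restrictBracket (μ : E →ₗ[ℝ] E →ₗ[ℝ] E) (p : Submodule ℝ E) :
    Rop (restrictBracket μ p) = RopOn μ p := by
  refine LinearMap.ext fun u => ext_inner_right ℝ fun v => ?_
  rw [inner_Rop, inner_RopOn]
  simp only [restrictBracket_apply]
  congr 2
  · exact (sum_inner_onbOf (stdONB E) p (μ.flip (projL p u)) (μ.flip (projL p v))).symm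
  · rw [Finset.sum_comm]
    conv_rhs => rw [Finset.sum_comm]
    refine Finset.sum_congr rfl fun l _ => ?_
    exact (sum_mul_onbOf (stdONB E) p (innerₗ E u ∘ₗ μ.flip (projL p (stdONB E l)))
      (innerₗ E v ∘ₗ μ.flip (projL p (stdONB E l)))).symm

/-- `Rop` commutes with symmetric derivations. -/
lemma Rop_comm_of_isDeriv {ν : E →ₗ[ℝ] E →ₗ[ℝ] E} {T : E →ₗ[ℝ] E} (hT : IsDeriv ν T)
    (hs : T.IsSymmetric) (u : E) : Rop ν (T u) = T (Rop ν u) := by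
  refine ext_inner_right ℝ fun v => ?_
  rw [hs, inner_Rop, inner_Rop]
  have hd : ∀ x y, ν x (T y) = T (ν x y) - ν (T x) y := fun x y => by rw [hT]; abel
  congr 2
  · simp only [hd, inner_sub_left, inner_sub_right, Finset.sum_sub_distrib]
    have h := (stdONB E).sum_inner_symmetric (ν.flip u) (ν.flip v) hs
    simp only [LinearMap.flip_apply] at h
    rw [h]
    simp only [hs _ _]
  · have hi : ∀ w x y, ⟪T w, ν x y⟫ = ⟪w, ν (T x) y⟫ + ⟪w, ν x (T y)⟫ := fun w x y => by
      rw [hs, hT, inner_add_right]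
    simp only [hi, add_mul, mul_add, Finset.sum_add_distrib]
    congr 1
    · rw [Finset.sum_comm]
      conv_rhs => rw [Finset.sum_comm]
      refine Finset.sum_congr rfl fun l _ => ?_
      exact (stdONB E).sum_mul_symmetric (innerₗ E u ∘ₗ ν.flip (stdONB E l))
        (innerₗ E v ∘ₗ ν.flip (stdONB E l)) hs
    · refine Finset.sum_congr rfl fun i _ => ?_
      exact (stdONB E).sum_mul_symmetric (innerₗ E u ∘ₗ ν (stdONB E i))
        (innerₗ E v ∘ₗ ν (stdONB E i)) hs

end RicciForms

section NilpotentIdeals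

variable {E : Type*} [AddCommGroup E] [Module ℝ E]

lemma lcsOn_isIdeal {μ : E →ₗ[ℝ] E →ₗ[ℝ] E} (hLie : IsLieBracket μ) {p : Submodule ℝ E}
    (hp : IsIdeal μ p) (k : ℕ) : IsIdeal μ (lcsOn μ p k) := by
  induction k with
  | zero => exact hp
  | succ k ih =>
    intro Z w hw
    simp only [lcsOn, bracketSpan] at hw ⊢
    induction hw using Submodule.span_induction with
    | mem w hw =>
      obtain ⟨x, hx, y, hy, rfl⟩ := hw
      rw [hLie.2]
      exact add_mem (Submodule.subset_span ⟨_, hp Z x hx, y, hy, rfl⟩)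
        (Submodule.subset_span ⟨x, hx, _, ih Z y hy, rfl⟩)
    | zero => simp
    | add a b _ _ ha hb => rw [map_add]; exact add_mem ha hb
    | smul r a _ ha => rw [map_smul]; exact Submodule.smul_mem _ _ ha

lemma IsLieBracket.skew {μ : E →ₗ[ℝ] E →ₗ[ℝ] E} (hLie : IsLieBracket μ) (x y : E) :
    μ x y = -μ y x := by
  have h := hLie.1 (x + y)
  simp only [map_add, LinearMap.add_apply, hLie.1, zero_add, add_zero] at h
  exact eq_neg_of_add_eq_zero_right h

lemma isNilpotent_of_lcsOn {μ : E →ₗ[ℝ] E →ₗ[ℝ] E} {p : Submodule ℝ E}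
    (hnil : IsNilpotentOn μ p) {f : E →ₗ[ℝ] E} (h0 : ∀ x, f x ∈ p)
    (hf : ∀ k, ∀ x ∈ lcsOn μ p k, f x ∈ lcsOn μ p (k + 1)) : IsNilpotent f := by
  obtain ⟨K, hK⟩ := hnil
  have key : ∀ k x, (f ^ (k + 1)) x ∈ lcsOn μ p k := by
    intro k
    induction k with
    | zero => intro x; simpa [lcsOn] using h0 x
    | succ k ih =>
      intro x
      rw [pow_succ', Module.End.mul_apply]
      exact hf k _ (ih x)
  refine ⟨K + 1, LinearMap.ext fun x => ?_⟩
  simpa [hK] using key K x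

lemma trace_eq_zero_of_mem_nilpotent_ideal {μ : E →ₗ[ℝ] E →ₗ[ℝ] E} (hLie : IsLieBracket μ)
    {p : Submodule ℝ E} (hp : IsIdeal μ p) (hnil : IsNilpotentOn μ p) {X : E} (hX : X ∈ p) :
    LinearMap.trace ℝ E (μ X) = 0 := by
  refine (LinearMap.isNilpotent_trace_of_isNilpotent
    (isNilpotent_of_lcsOn hnil (fun x => ?_) fun k x hx => ?_)).eq_zero
  · rw [hLie.skew]; exact neg_mem (hp _ _ hX)
  · exact Submodule.subset_span ⟨X, hX, x, hx, rfl⟩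

lemma trace_comp_eq_zero_of_mem_nilpotent_ideal {μ : E →ₗ[ℝ] E →ₗ[ℝ] E} (hLie : IsLieBracket μ)
    {p : Submodule ℝ E} (hp : IsIdeal μ p) (hnil : IsNilpotentOn μ p) {X : E} (hX : X ∈ p)
    (Y : E) : LinearMap.trace ℝ E (μ Y ∘ₗ μ X) = 0 := by
  refine (LinearMap.isNilpotent_trace_of_isNilpotent
    (isNilpotent_of_lcsOn hnil (fun x => ?_) fun k x hx => ?_)).eq_zero
  · rw [LinearMap.comp_apply, hLie.skew X]
    exact hp _ _ (neg_mem (hp _ _ hX))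
  · exact lcsOn_isIdeal hLie hp (k + 1) Y _ (Submodule.subset_span ⟨X, hX, x, hx, rfl⟩)

end NilpotentIdeals

section Extension

variable {E : Type*} [NormedAddCommGroup E] [InnerProductSpace ℝ E] [FiniteDimensional ℝ E]
variable {μ : E →ₗ[ℝ] E →ₗ[ℝ] E} {n : Submodule ℝ E}

lemma apply_sub_projL (habel : ∀ A ∈ nᗮ, ∀ A' ∈ nᗮ, μ A A' = 0) {A : E} (hA : A ∈ nᗮ) (y : E) :
    μ A (projL n y) = μ A y := by
  have h := habel A hA _ (sub_projL_mem n y)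
  rw [map_sub, sub_eq_zero] at h
  exact h.symm

lemma apply_mem_of_orthogonal (hid : IsIdeal μ n) (habel : ∀ A ∈ nᗮ, ∀ A' ∈ nᗮ, μ A A' = 0)
    {A : E} (hA : A ∈ nᗮ) (y : E) : μ A y ∈ n := by
  rw [← apply_sub_projL habel hA]
  exact hid _ _ (projL_mem n y)

lemma meanCurv_mem (h : ∀ X ∈ n, LinearMap.trace ℝ E (μ X) = 0) : meanCurv μ ∈ nᗮ := by
  intro X hX
  have hX' := h X hX
  rw [← (stdONB E).sum_repr' X] at hX'
  simp only [map_sum, map_smul, smul_eq_mul] at hX'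
  simp only [meanCurv, inner_sum, real_inner_smul_right]
  rw [← hX']
  exact Finset.sum_congr rfl fun i _ => by rw [real_inner_comm, mul_comm]

lemma symPart_of_isSymmetric {f : E →ₗ[ℝ] E} (hf : f.IsSymmetric) : symPart f = f := by
  have : transp f = f := (LinearMap.isSymmetric_iff_isSelfAdjoint f).1 hf
  rw [symPart, this, ← two_smul ℝ f, smul_smul]
  norm_num

/-- The operator `R` of an orthogonal semidirect product `nᗮ ⋉ n`, with `nᗮ` abelian acting by
symmetric operators, in terms of the one of `n`. -/
lemma inner_Rop_extension (hLie : IsLieBracket μ) (hid : IsIdeal μ n)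
    (hnil : IsNilpotentOn μ n) (habel : ∀ A ∈ nᗮ, ∀ A' ∈ nᗮ, μ A A' = 0)
    (hsym : ∀ A ∈ nᗮ, (μ A).IsSymmetric) (u v : E) :
    ⟪Rop μ u, v⟫ = ⟪RopOn μ n u, v⟫
      - (1 / 2) * LinearMap.trace ℝ E (μ (u - projL n u) ∘ₗ μ (v - projL n v)) := by
  have hQ := sub_projL_mem n
  have hL : ∀ x y, μ (x - projL n x) (projL n y) = μ (x - projL n x) y :=
    fun x y => apply_sub_projL habel (hQ x) y
  have hdec : ∀ x y, μ (projL n x) y = restrictBracket μ n x y - μ (y - projL n y) x := by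
    intro x y
    rw [restrictBracket_apply, ← hL y x, hLie.skew (y - projL n y), map_sub]
    abel
  have hcross : ∀ x y, ∑ i, ⟪restrictBracket μ n (stdONB E i) x,
      μ (y - projL n y) (stdONB E i)⟫ = 0 := by
    intro x y
    have htr := trace_comp_eq_zero_of_mem_nilpotent_ideal hLie hid hnil (projL_mem n x)
      (y - projL n y)
    have hP : projL n ∘ₗ μ (y - projL n y) = μ (y - projL n y) :=
      LinearMap.ext fun z => projL_of_mem (apply_mem_of_orthogonal hid habel (hQ y) z)
    rw [← hP, LinearMap.comp_assoc, LinearMap.trace_comp_comm',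
      LinearMap.trace_eq_sum_inner _ (stdONB E)] at htr
    rw [← neg_eq_zero, ← Finset.sum_neg_distrib, ← htr]
    refine Finset.sum_congr rfl fun i _ => ?_
    simp only [LinearMap.comp_apply]
    rw [← hsym _ (hQ y) (stdONB E i) (μ (projL n x) _), restrictBracket_apply,
      hLie.skew (projL n (stdONB E i)), inner_neg_left, neg_neg,
      real_inner_comm]
  have htrace : ∑ i, ⟪μ (u - projL n u) (stdONB E i), μ (v - projL n v) (stdONB E i)⟫
      = LinearMap.trace ℝ E (μ (u - projL n u) ∘ₗ μ (v - projL n v)) := by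
    rw [LinearMap.trace_eq_sum_inner _ (stdONB E)]
    refine Finset.sum_congr rfl fun i _ => ?_
    rw [LinearMap.comp_apply, hsym _ (hQ u)]
  have hfirst : ∑ i, ⟪μ (stdONB E i) u, μ (stdONB E i) v⟫
      = ∑ i, ⟪restrictBracket μ n (stdONB E i) u, restrictBracket μ n (stdONB E i) v⟫
        + LinearMap.trace ℝ E (μ (u - projL n u) ∘ₗ μ (v - projL n v))
        + ∑ i, ⟪μ (stdONB E i - projL n (stdONB E i)) u,
            μ (stdONB E i - projL n (stdONB E i)) v⟫ := by
    have h := sum_inner_split (stdONB E) n (μ.flip u) (μ.flip v)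
    simp only [LinearMap.flip_apply] at h
    rw [h]
    congr 1
    simp only [hdec, inner_sub_left, inner_sub_right, Finset.sum_sub_distrib]
    rw [hcross, htrace]
    have h' := hcross v u
    simp only [real_inner_comm] at h' ⊢
    rw [h']
    ring
  have hsecond : ∑ i, ∑ l, ⟪u, μ (stdONB E i) (stdONB E l)⟫ * ⟪v, μ (stdONB E i) (stdONB E l)⟫
      = ∑ i, ∑ l, ⟪u, restrictBracket μ n (stdONB E i) (stdONB E l)⟫
          * ⟪v, restrictBracket μ n (stdONB E i) (stdONB E l)⟫
        + 2 * ∑ i, ⟪μ (stdONB E i - projL n (stdONB E i)) u,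
            μ (stdONB E i - projL n (stdONB E i)) v⟫ := by
    have hA : ∑ i, ∑ l, ⟪u, μ (stdONB E i - projL n (stdONB E i)) (stdONB E l)⟫
          * ⟪v, μ (stdONB E i - projL n (stdONB E i)) (stdONB E l)⟫
        = ∑ i, ⟪μ (stdONB E i - projL n (stdONB E i)) u,
            μ (stdONB E i - projL n (stdONB E i)) v⟫ := by
      refine Finset.sum_congr rfl fun i _ => ?_
      rw [← (stdONB E).sum_inner_mul_inner]
      refine Finset.sum_congr rfl fun l _ => ?_
      rw [← hsym _ (hQ _), ← hsym _ (hQ _), real_inner_comm (stdONB E l) (μ _ v)]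
    have hB : ∀ i, ∑ l, ⟪u, μ (projL n (stdONB E i)) (stdONB E l)⟫
          * ⟪v, μ (projL n (stdONB E i)) (stdONB E l)⟫
        = ∑ l, ⟪u, restrictBracket μ n (stdONB E i) (stdONB E l)⟫
            * ⟪v, restrictBracket μ n (stdONB E i) (stdONB E l)⟫
          + ∑ l, ⟪u, μ (stdONB E l - projL n (stdONB E l)) (stdONB E i)⟫
            * ⟪v, μ (stdONB E l - projL n (stdONB E l)) (stdONB E i)⟫ := by
      intro i
      have h := sum_mul_split (stdONB E) n (innerₗ E u ∘ₗ μ (projL n (stdONB E i)))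
        (innerₗ E v ∘ₗ μ (projL n (stdONB E i)))
      simp only [LinearMap.comp_apply, innerₗ_apply_apply] at h
      rw [h]
      congr 1
      refine Finset.sum_congr rfl fun l _ => ?_
      rw [hLie.skew, hL, inner_neg_right, inner_neg_right, neg_mul_neg]
    have hC : ∑ i, ∑ l, ⟪u, μ (stdONB E i) (stdONB E l)⟫ * ⟪v, μ (stdONB E i) (stdONB E l)⟫
        = ∑ i, ∑ l, ⟪u, μ (projL n (stdONB E i)) (stdONB E l)⟫
            * ⟪v, μ (projL n (stdONB E i)) (stdONB E l)⟫
          + ∑ i, ∑ l, ⟪u, μ (stdONB E i - projL n (stdONB E i)) (stdONB E l)⟫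
            * ⟪v, μ (stdONB E i - projL n (stdONB E i)) (stdONB E l)⟫ := by
      rw [Finset.sum_comm]
      rw [Finset.sum_comm (f := fun i l => ⟪u, μ (projL n (stdONB E i)) (stdONB E l)⟫
            * ⟪v, μ (projL n (stdONB E i)) (stdONB E l)⟫)]
      rw [Finset.sum_comm (f := fun i l =>
            ⟪u, μ (stdONB E i - projL n (stdONB E i)) (stdONB E l)⟫
            * ⟪v, μ (stdONB E i - projL n (stdONB E i)) (stdONB E l)⟫)]
      rw [← Finset.sum_add_distrib]
      refine Finset.sum_congr rfl fun l _ => ?_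
      exact sum_mul_split (stdONB E) n (innerₗ E u ∘ₗ μ.flip (stdONB E l))
        (innerₗ E v ∘ₗ μ.flip (stdONB E l))
    rw [hC]
    simp_rw [hB]
    rw [Finset.sum_add_distrib, hA]
    conv_lhs => enter [1, 2]; rw [Finset.sum_comm]
    rw [hA]
    ring
  rw [← Rop_restrictBracket, inner_Rop, inner_Rop, hfirst, hsecond]
  ring

lemma RopOn_of_mem_orthogonal (hid : IsIdeal μ n) {A : E} (hA : A ∈ nᗮ) :
    RopOn μ n A = 0 := by
  refine ext_inner_right ℝ fun v => ?_
  have h : ∀ x, ∀ y, ⟪A, μ x (projL n y)⟫ = 0 := fun x y =>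
    Submodule.inner_left_of_mem_orthogonal (hid _ _ (projL_mem n y)) hA
  simp [inner_RopOn, projL_of_mem_orthogonal hA, h]

lemma RopOn_comm (hLie : IsLieBracket μ) (hid : IsIdeal μ n)
    (habel : ∀ A ∈ nᗮ, ∀ A' ∈ nᗮ, μ A A' = 0) {A : E} (hA : A ∈ nᗮ)
    (hsym : (μ A).IsSymmetric) (u : E) : RopOn μ n (μ A u) = μ A (RopOn μ n u) := by
  rw [← Rop_restrictBracket]
  refine Rop_comm_of_isDeriv (fun X Y => ?_) hsym u
  simp only [restrictBracket_apply]
  rw [projL_of_mem (apply_mem_of_orthogonal hid habel hA X),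
    projL_of_mem (apply_mem_of_orthogonal hid habel hA Y), hLie.2,
    apply_sub_projL habel hA, apply_sub_projL habel hA]

/-- A derivation of the ideal `n` commuting with `ad A`, `A ∈ nᗮ`, extends by zero on `nᗮ`. -/
lemma isDeriv_comp_projL (hLie : IsLieBracket μ) (hid : IsIdeal μ n)
    (habel : ∀ A ∈ nᗮ, ∀ A' ∈ nᗮ, μ A A' = 0) {D₁ : E →ₗ[ℝ] E}
    (hder : ∀ X ∈ n, ∀ Y ∈ n, D₁ (μ X Y) = μ (D₁ X) Y + μ X (D₁ Y))
    (hcomm : ∀ A ∈ nᗮ, ∀ X ∈ n, D₁ (μ A X) = μ A (D₁ X)) :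
    IsDeriv μ (D₁ ∘ₗ projL n) := by
  intro X Y
  have hPX := projL_mem n X
  have hPY := projL_mem n Y
  have hQX := sub_projL_mem n X
  have hQY := sub_projL_mem n Y
  have hXY : μ X Y = μ (projL n X) (projL n Y) + μ (X - projL n X) (projL n Y)
      - μ (Y - projL n Y) (projL n X) := by
    rw [apply_sub_projL habel hQX, hLie.skew (Y - _)]
    simp only [map_sub, LinearMap.sub_apply]
    abel
  have hXYmem : μ X Y ∈ n := by
    rw [hXY]
    exact sub_mem (add_mem (hid _ _ hPY) (hid _ _ hPY)) (hid _ _ hPX)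
  rw [LinearMap.comp_apply, LinearMap.comp_apply, LinearMap.comp_apply, projL_of_mem hXYmem, hXY,
    map_sub, map_add, hder _ hPX _ hPY, hcomm _ hQX _ hPY, hcomm _ hQY _ hPX,
    hLie.skew (Y - _)]
  simp only [map_sub, LinearMap.sub_apply]
  abel

end Extension

/-- the standard construction of a solsoliton from a nilsoliton `(n, ⟨⬝,⬝⟩₁)`
together with an abelian Lie algebra `a` of symmetric derivations of `n`.  The resulting metric
solvable Lie algebra `s = a ⋉ n` is characterized by: `n` is its nilradical, `a = nᗮ` is abelian,
each `ad A` (`A ∈ a`) is symmetric (acting on `n` by the given derivations), and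
`⟨A, A'⟩ = -(1/c) tr(ad A ∘ ad A')`.  Conclusion: `Ric = c I + D` for the derivation `D` with
`D|_a = 0` and `D|_n = D₁ - ad H|_n`. -/
theorem solsoliton_of_nilsoliton_construction
    {E : Type*} [NormedAddCommGroup E] [InnerProductSpace ℝ E] [FiniteDimensional ℝ E]
    (μ : E →ₗ[ℝ] E →ₗ[ℝ] E) (hLie : IsLieBracket μ) (hsolv : IsSolvableB μ)
    (n : Submodule ℝ E) (hn : IsNilradical μ n)
    (c : ℝ) (hc : c < 0) (D₁ : E →ₗ[ℝ] E)
    (hnilsol : IsNilsolitonOn μ n c D₁)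
    (habel : ∀ A ∈ nᗮ, ∀ A' ∈ nᗮ, μ A A' = 0)
    (hsym : ∀ A ∈ nᗮ, (μ A).IsSymmetric)
    (hip : ∀ A ∈ nᗮ, ∀ A' ∈ nᗮ,
      ⟪A, A'⟫ = -(1 / c) * LinearMap.trace ℝ E ((μ A) ∘ₗ (μ A'))) :
    ∃ D : E →ₗ[ℝ] E, IsDeriv μ D ∧ Ric μ = c • LinearMap.id + D ∧
      (∀ A ∈ nᗮ, D A = 0) ∧ ∀ X ∈ n, D X = D₁ X - μ (meanCurv μ) X := by
  obtain ⟨hid, hnil, -⟩ := hn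
  obtain ⟨-, hder, hR⟩ := hnilsol
  have hH : meanCurv μ ∈ nᗮ :=
    meanCurv_mem fun X hX => trace_eq_zero_of_mem_nilpotent_ideal hLie hid hnil hX
  have hQ := sub_projL_mem n
  have hcomm : ∀ A ∈ nᗮ, ∀ X ∈ n, D₁ (μ A X) = μ A (D₁ X) := by
    intro A hA X hX
    have h := RopOn_comm hLie hid habel hA (hsym A hA) X
    rw [hR _ (hid A X hX), hR X hX, map_add, map_smul] at h
    exact add_left_cancel h
  have htr : ∀ u v, LinearMap.trace ℝ E (μ (u - projL n u) ∘ₗ μ (v - projL n v))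
      = -c * ⟪u - projL n u, v⟫ := by
    intro u v
    have h := hip _ (hQ u) _ (hQ v)
    rw [inner_sub_right, Submodule.inner_left_of_mem_orthogonal (projL_mem n v) (hQ u),
      sub_zero] at h
    rw [h]
    field_simp [hc.ne]
  have hB : ∀ u v, LinearMap.trace ℝ E (μ u ∘ₗ μ v)
      = LinearMap.trace ℝ E (μ (u - projL n u) ∘ₗ μ (v - projL n v)) := by
    intro u v
    have h1 := fun Y x => trace_comp_eq_zero_of_mem_nilpotent_ideal hLie hid hnil (projL_mem n x) Y
    have h2 : LinearMap.trace ℝ E (μ (projL n u) ∘ₗ μ v) = 0 := by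
      rw [LinearMap.trace_comp_comm']; exact h1 v u
    simp only [map_sub, LinearMap.comp_sub, LinearMap.sub_comp, h1, h2, sub_zero]
  refine ⟨D₁ ∘ₗ projL n - μ (meanCurv μ), ?_, ?_, fun A hA => ?_, fun X hX => ?_⟩
  · intro X Y
    have h := isDeriv_comp_projL hLie hid habel hder hcomm X Y
    simp only [LinearMap.sub_apply, map_sub, h, hLie.2 (meanCurv μ)]
    abel
  · have hRop : ∀ u, RopOn μ n u = c • projL n u + D₁ (projL n u) := by
      intro u
      have h := RopOn_of_mem_orthogonal hid (hQ u)
      rw [map_sub, sub_eq_zero] at h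
      rw [h, hR _ (projL_mem n u)]
    refine LinearMap.ext fun u => ext_inner_right ℝ fun v => ?_
    rw [Ric, symPart_of_isSymmetric (hsym _ hH)]
    simp only [LinearMap.sub_apply, LinearMap.add_apply, LinearMap.smul_apply, LinearMap.id_apply,
      LinearMap.comp_apply, inner_sub_left, inner_add_left, real_inner_smul_left, inner_Bop]
    rw [inner_Rop_extension hLie hid hnil habel hsym, hB u v, htr, hRop]
    simp only [inner_sub_left, inner_add_left, real_inner_smul_left]
    ring
  · simp [projL_of_mem_orthogonal hA, habel _ hH A hA]
  · simp [projL_of_mem hX]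
end
end

section
/- Let (s, ⟨·,·⟩) be a metric solvable Lie algebra and let E be any derivation of s. Then tr(R·[E, Eᵗ]) = (1/4)·‖π(Eᵗ)[·,·]‖², where [·,·] denotes the Lie bracket of s regarded as a bilinear map s × s → s. In particular, if [E, Eᵗ] = 0 then Eᵗ is also a derivation of s. -/
noncomputable section

open scoped RealInnerProductSpace

section PiAct

variable {E : Type*} [AddCommGroup E] [Module ℝ E]

@[simp]
theorem piAct_apply (f : E →ₗ[ℝ] E) (μ : E →ₗ[ℝ] E →ₗ[ℝ] E) (X Y : E) :
    piAct f μ X Y = f (μ X Y) - μ (f X) Y - μ X (f Y) := rfl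

theorem isDeriv_iff_piAct_eq_zero {μ : E →ₗ[ℝ] E →ₗ[ℝ] E} {f : E →ₗ[ℝ] E} :
    IsDeriv μ f ↔ piAct f μ = 0 := by
  simp only [IsDeriv, LinearMap.ext_iff, piAct_apply, LinearMap.zero_apply, sub_sub, sub_eq_zero]

theorem piAct_commutator (f g : E →ₗ[ℝ] E) (μ : E →ₗ[ℝ] E →ₗ[ℝ] E) :
    piAct (f ∘ₗ g - g ∘ₗ f) μ = piAct f (piAct g μ) - piAct g (piAct f μ) := by
  ext X Y
  simp only [piAct_apply, LinearMap.sub_apply, LinearMap.comp_apply, map_sub]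
  abel

end PiAct

section MetricLemmas

variable {E : Type*} [NormedAddCommGroup E] [InnerProductSpace ℝ E] [FiniteDimensional ℝ E]

theorem OrthonormalBasis.sum_map_apply_left {ι : Type*} [Fintype ι] (b : OrthonormalBasis ι ℝ E)
    (A : E →ₗ[ℝ] E) (g : E →ₗ[ℝ] E →ₗ[ℝ] ℝ) :
    ∑ i, g (A (b i)) (b i) = ∑ i, g (b i) (transp A (b i)) := by
  have h₁ : ∀ i, g (A (b i)) (b i) = ∑ k, ⟪b k, A (b i)⟫ * g (b k) (b i) := fun i ↦ by
    conv_lhs => rw [← b.sum_repr' (A (b i))]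
    simp
  have h₂ : ∀ i, g (b i) (transp A (b i)) = ∑ k, ⟪b k, transp A (b i)⟫ * g (b i) (b k) := fun i ↦ by
    conv_lhs => rw [← b.sum_repr' (transp A (b i))]
    simp
  simp only [h₁, h₂]
  rw [Finset.sum_comm]
  refine Finset.sum_congr rfl fun i _ ↦ Finset.sum_congr rfl fun k _ ↦ ?_
  rw [transp, LinearMap.adjoint_inner_right, real_inner_comm]

theorem OrthonormalBasis.sum_inner_map_apply {ι : Type*} [Fintype ι] (b : OrthonormalBasis ι ℝ E)
    (A u v : E →ₗ[ℝ] E) :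
    ∑ i, ⟪u (A (b i)), v (b i)⟫ = ∑ i, ⟪u (b i), v (transp A (b i))⟫ := by
  simpa using b.sum_map_apply_left A ((innerₗ E).compl₁₂ u v)

theorem binner_piAct_left (A : E →ₗ[ℝ] E) (μ ν : E →ₗ[ℝ] E →ₗ[ℝ] E) :
    binner (piAct A μ) ν = binner μ (piAct (transp A) ν) := by
  simp only [binner, piAct_apply, inner_sub_left, inner_sub_right, Finset.sum_sub_distrib]
  congr 1
  · congr 1
    · simp only [transp, LinearMap.adjoint_inner_right]
    · rw [Finset.sum_comm, Finset.sum_comm (f := fun i j ↦ ⟪μ (stdONB E i) (stdONB E j), _⟫)]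
      exact Finset.sum_congr rfl fun j _ ↦
        (stdONB E).sum_inner_map_apply A (μ.flip (stdONB E j)) (ν.flip (stdONB E j))
  · exact Finset.sum_congr rfl fun i _ ↦
      (stdONB E).sum_inner_map_apply A (μ (stdONB E i)) (ν (stdONB E i))

theorem binner_self_eq_zero {μ : E →ₗ[ℝ] E →ₗ[ℝ] E} (h : binner μ μ = 0) : μ = 0 := by
  refine (stdONB E).toBasis.ext fun i ↦ (stdONB E).toBasis.ext fun j ↦ ?_
  have hi := (Finset.sum_eq_zero_iff_of_nonneg fun i _ ↦
    Finset.sum_nonneg fun j _ ↦ real_inner_self_nonneg).1 h i (Finset.mem_univ i)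
  have hij := (Finset.sum_eq_zero_iff_of_nonneg fun j _ ↦
    real_inner_self_nonneg).1 hi j (Finset.mem_univ j)
  simpa using hij

theorem trace_Rop_comp {μ : E →ₗ[ℝ] E →ₗ[ℝ] E} (hμ : ∀ X, μ X X = 0) (A : E →ₗ[ℝ] E) :
    LinearMap.trace ℝ E (Rop μ ∘ₗ A) = 1 / 4 * binner (piAct A μ) μ := by
  have hswap : ∀ X Y, μ X Y = -μ Y X := fun X Y ↦ (LinearMap.IsAlt.neg hμ Y X).symm
  have h₁ : ∀ i, LinearMap.trace ℝ E ((transp (μ (stdONB E i)) ∘ₗ μ (stdONB E i)) ∘ₗ A) =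
      ∑ j, ⟪μ (stdONB E i) (A (stdONB E j)), μ (stdONB E i) (stdONB E j)⟫ := fun i ↦ by
    rw [LinearMap.trace_eq_sum_inner _ (stdONB E)]
    refine Finset.sum_congr rfl fun j _ ↦ ?_
    simp only [LinearMap.comp_apply, transp, LinearMap.adjoint_inner_right]
    exact real_inner_comm _ _
  have h₂ : ∀ i, LinearMap.trace ℝ E ((μ (stdONB E i) ∘ₗ transp (μ (stdONB E i))) ∘ₗ A) =
      ∑ j, ⟪A (μ (stdONB E i) (stdONB E j)), μ (stdONB E i) (stdONB E j)⟫ := fun i ↦ by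
    rw [LinearMap.comp_assoc, LinearMap.trace_comp_comm', LinearMap.trace_eq_sum_inner _ (stdONB E)]
    refine Finset.sum_congr rfl fun j _ ↦ ?_
    simp only [LinearMap.comp_apply, transp, LinearMap.adjoint_inner_right]
    exact real_inner_comm _ _
  have h₃ : ∑ i, ∑ j, ⟪μ (A (stdONB E i)) (stdONB E j), μ (stdONB E i) (stdONB E j)⟫ =
      ∑ i, ∑ j, ⟪μ (stdONB E i) (A (stdONB E j)), μ (stdONB E i) (stdONB E j)⟫ := by
    rw [Finset.sum_comm]
    refine Finset.sum_congr rfl fun i _ ↦ Finset.sum_congr rfl fun j _ ↦ ?_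
    rw [hswap (A _), hswap (stdONB E j), inner_neg_neg]
  have hsum : ∀ T : Fin (Module.finrank ℝ E) → E →ₗ[ℝ] E, (∑ i, T i) ∘ₗ A = ∑ i, T i ∘ₗ A :=
    fun T ↦ by ext; simp
  simp only [binner, piAct_apply, inner_sub_left, Finset.sum_sub_distrib, h₃]
  simp only [Rop, LinearMap.add_comp, LinearMap.smul_comp, hsum, map_add, map_smul,
    map_sum, h₁, h₂, smul_eq_mul]
  ring

end MetricLemmas

/-- for any derivation `f` of a metric solvable Lie algebra,
`tr (R ∘ [f, fᵗ]) = (1/4) ‖π(fᵗ)[⬝,⬝]‖²`; in particular if `[f, fᵗ] = 0` then `fᵗ` is also a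
derivation. -/
theorem trace_R_commutator_deriv
    {E : Type*} [NormedAddCommGroup E] [InnerProductSpace ℝ E] [FiniteDimensional ℝ E]
    (μ : E →ₗ[ℝ] E →ₗ[ℝ] E) (hLie : IsLieBracket μ) (hsolv : IsSolvableB μ)
    (f : E →ₗ[ℝ] E) (hf : IsDeriv μ f) :
    LinearMap.trace ℝ E (Rop μ ∘ₗ (f ∘ₗ transp f - transp f ∘ₗ f)) =
        (1 / 4) * binner (piAct (transp f) μ) (piAct (transp f) μ) ∧
      (f ∘ₗ transp f = transp f ∘ₗ f → IsDeriv μ (transp f)) := by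
  have hf' : piAct f μ = 0 := isDeriv_iff_piAct_eq_zero.1 hf
  have htt : transp (transp f) = f := LinearMap.adjoint_adjoint f
  have key : LinearMap.trace ℝ E (Rop μ ∘ₗ (f ∘ₗ transp f - transp f ∘ₗ f)) =
      1 / 4 * binner (piAct (transp f) μ) (piAct (transp f) μ) := by
    have h₀ : piAct (transp f) (0 : E →ₗ[ℝ] E →ₗ[ℝ] E) = 0 := by ext; simp
    rw [trace_Rop_comp hLie.1, piAct_commutator, hf', h₀, sub_zero, binner_piAct_left]
  refine ⟨key, fun hcomm ↦ isDeriv_iff_piAct_eq_zero.2 (binner_self_eq_zero ?_)⟩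
  rw [hcomm, sub_self, LinearMap.comp_zero, map_zero] at key
  linarith
end
end
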